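/- Variational characterization of the delayed thermostat output: let ρ₋₁ < ρ₁, set O₋₁ = (−∞,ρ₁]×{−1} and O₁ = [ρ₋₁,∞)×{1}, and let X : [0,∞) → ℝ be continuous and w ∈ {−1,1} with (X(0),w) ∈ O₋₁ ∪ O₁. Then W = h_ρ[X;w] is the unique left-continuous function W : [0,∞) → {−1,1} such that W(0) = w, (X(t),W(t)) ∈ O₋₁ ∪ O₁ for all t ≥ 0, and for every t ≥ 0, Var_{[0,t]} W = min{ Var_{[0,t]} W̃ : W̃ left-continuous with values in {−1,1}, W̃(0) = w, and (X(τ),W̃(τ)) ∈ O₋₁ ∪ O₁ for all τ ∈ [0,t] }, where Var_{[0,t]} denotes the total variation on [0,t]. -/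

import Mathlib

open Filter Set Topology

/-- The set of times `τ ∈ [0, t)` at which the input `X` is strictly beyond one of the
thresholds `ρm < ρp`. -/
def crossSet (ρm ρp : ℝ) (X : ℝ → ℝ) (t : ℝ) : Set ℝ :=
  {τ | 0 ≤ τ ∧ τ < t ∧ (X τ < ρm ∨ ρp < X τ)}

/-- `W` is the output of the delayed thermostat with thresholds `ρm < ρp`, input `X`
and initial output `w`. -/
structure IsThermostat (ρm ρp : ℝ) (X : ℝ → ℝ) (w : ℝ) (W : ℝ → ℝ) : Prop where
  leftCont : ∀ t : ℝ, 0 < t → Tendsto W (nhdsWithin t (Iio t)) (nhds (W t))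
  values : ∀ t : ℝ, 0 ≤ t → W t = 1 ∨ W t = -1
  high : ∀ t : ℝ, 0 ≤ t → ρp < X t → W t = 1
  low : ∀ t : ℝ, 0 ≤ t → X t < ρm → W t = -1
  band : ∀ t : ℝ, 0 ≤ t → ρm ≤ X t → X t ≤ ρp →
    ((crossSet ρm ρp X t).Nonempty →
      Tendsto W (nhdsWithin (sSup (crossSet ρm ρp X t)) (Iio (sSup (crossSet ρm ρp X t))))
        (nhds (W t))) ∧
    (¬ (crossSet ρm ρp X t).Nonempty → W t = w)

/-- The set `O₋₁ ∪ O₁ = ((-∞, ρp] × {-1}) ∪ ([ρm, ∞) × {1})` where the pair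
(input, output) must evolve. -/
def OSet (ρm ρp : ℝ) : Set (ℝ × ℝ) :=
  (Iic ρp ×ˢ ({-1} : Set ℝ)) ∪ (Ici ρm ×ˢ ({1} : Set ℝ))

/-- A competitor in the variational characterization: a left-continuous function with
values in `{-1,1}`, starting at `w`, whose pair with the input `X` satisfies the
constraint `(X τ, V τ) ∈ O₋₁ ∪ O₁` for all `τ ∈ [0, t]`. -/
def Admissible (ρm ρp : ℝ) (X : ℝ → ℝ) (w : ℝ) (t : ℝ) (V : ℝ → ℝ) : Prop :=
  (∀ s : ℝ, 0 < s → Tendsto V (nhdsWithin s (Iio s)) (nhds (V s))) ∧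
  (∀ s : ℝ, 0 ≤ s → V s = 1 ∨ V s = -1) ∧
  V 0 = w ∧
  ∀ τ ∈ Icc (0 : ℝ) t, (X τ, V τ) ∈ OSet ρm ρp

lemma eVariationOn_Icc_add_Icc (f : ℝ → ℝ) {a b c : ℝ} (hab : a ≤ b) (hbc : b ≤ c) :
    eVariationOn f (Icc a b) + eVariationOn f (Icc b c) = eVariationOn f (Icc a c) := by
  simpa using eVariationOn.Icc_add_Icc f hab hbc (mem_univ b)

lemma AntitoneOn.boundedVariationOn_of_abs_le {f : ℝ → ℝ} {s : Set ℝ} {C : ℝ}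
    (hf : AntitoneOn f s) (h : ∀ x ∈ s, |f x| ≤ C) : BoundedVariationOn f s := by
  have key : BoundedVariationOn (-f) s :=
    hf.neg.boundedVariationOn (C := C) fun x hx => by simpa using h x hx
  have heq : eVariationOn (-f) s = eVariationOn f s := by
    simp [eVariationOn, edist_neg_neg]
  exact fun htop => key (heq.trans htop)

/-- A function on `[0, t]` whose restriction to every interval shorter than `δ` has bounded
variation has bounded variation. -/
lemma boundedVariationOn_Icc_of_short {f : ℝ → ℝ} {t δ : ℝ} (ht : 0 ≤ t) (hδ : 0 < δ)
    (h : ∀ a b, 0 ≤ a → a ≤ b → b ≤ t → b - a < δ → BoundedVariationOn f (Icc a b)) :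
    BoundedVariationOn f (Icc 0 t) := by
  have key : ∀ n : ℕ, BoundedVariationOn f (Icc 0 (min t (n * (δ / 2)))) := by
    intro n
    induction n with
    | zero => exact h _ _ le_rfl (by simp [ht]) (min_le_left _ _) (by simp [ht, hδ])
    | succ n ih =>
      have hn : (0 : ℝ) ≤ n * (δ / 2) := by positivity
      have hab : min t (n * (δ / 2)) ≤ min t ((n + 1 : ℕ) * (δ / 2)) := by
        push_cast
        exact min_le_min_left _ (by nlinarith)
      have hlen : min t ((n + 1 : ℕ) * (δ / 2)) - min t (n * (δ / 2)) < δ := by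
        push_cast
        rcases min_cases t (n * (δ / 2)) with h1 | h1 <;>
          rcases min_cases t ((n + 1 : ℝ) * (δ / 2)) with h2 | h2 <;> nlinarith
      have h2 := h _ _ (le_min ht hn) hab (min_le_left _ _) hlen
      rw [BoundedVariationOn, ← eVariationOn_Icc_add_Icc f (le_min ht hn) hab]
      exact ENNReal.add_ne_top.2 ⟨ih, h2⟩
  obtain ⟨n, hn⟩ := exists_nat_ge (t / (δ / 2))
  have := key n
  rwa [min_eq_left ((div_le_iff₀ (by positivity)).1 hn)] at this

section Thermostat

variable {ρm ρp : ℝ} {X : ℝ → ℝ} {w : ℝ} {W V : ℝ → ℝ}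

lemma eq_one_of_mem_OSet {x v : ℝ} (h : (x, v) ∈ OSet ρm ρp) (hx : ρp < x) : v = 1 := by
  rcases h with h | h
  · exact absurd h.1 (not_le.2 hx)
  · exact h.2

lemma eq_neg_one_of_mem_OSet {x v : ℝ} (h : (x, v) ∈ OSet ρm ρp) (hx : x < ρm) : v = -1 := by
  rcases h with h | h
  · exact h.2
  · exact absurd h.1 (not_le.2 hx)

lemma IsThermostat.eq_of_mem_OSet (hW : IsThermostat ρm ρp X w W) {r v : ℝ} (hr : 0 ≤ r)
    (hv : (X r, v) ∈ OSet ρm ρp) (hX : X r < ρm ∨ ρp < X r) : v = W r := by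
  rcases hX with h | h
  · rw [eq_neg_one_of_mem_OSet hv h, hW.low r hr h]
  · rw [eq_one_of_mem_OSet hv h, hW.high r hr h]

lemma exists_gt_mem_crossSet (hX : ContinuousOn X (Ici 0)) {b c : ℝ}
    (hc : c ∈ crossSet ρm ρp X b) : ∃ d ∈ crossSet ρm ρp X b, c < d := by
  obtain ⟨hc0, hcb, hc⟩ := hc
  have hcont : Tendsto X (𝓝[>] c) (𝓝 (X c)) :=
    (hX c hc0).mono_left (nhdsWithin_mono _ fun x hx => hc0.trans (le_of_lt hx))
  have hbeyond : ∀ᶠ x in 𝓝[>] c, X x < ρm ∨ ρp < X x := by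
    rcases hc with h | h
    · exact (hcont.eventually_lt_const h).mono fun _ => Or.inl
    · exact (hcont.eventually_const_lt h).mono fun _ => Or.inr
  obtain ⟨d, ⟨hd, hdc, hdb⟩⟩ := (hbeyond.and (Ioo_mem_nhdsGT hcb)).exists
  exact ⟨d, ⟨hc0.trans hdc.le, hdb, hd⟩, hdc⟩

/-- Whenever the output changes between `a` and `b`, the input is beyond a threshold at some time
in `[a, b]` at which the output has its final value. -/
lemma IsThermostat.exists_beyond_of_ne (hW : IsThermostat ρm ρp X w W)
    (hX : ContinuousOn X (Ici 0)) {a b : ℝ} (ha : 0 ≤ a) (hab : a ≤ b) (hne : W a ≠ W b) :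
    ∃ r ∈ Icc a b, (X r < ρm ∨ ρp < X r) ∧ W r = W b := by
  by_contra! hcon
  have hab' : a < b := hab.lt_of_ne fun h => hne (by rw [h])
  have hb : ρm ≤ X b ∧ X b ≤ ρp := by
    by_contra hb
    refine hcon b ⟨hab, le_rfl⟩ ?_ rfl
    by_contra! h
    exact hb h
  obtain ⟨hband, hempty⟩ := hW.band b (ha.trans hab) hb.1 hb.2
  by_cases hlate : ∃ c ∈ crossSet ρm ρp X b, a < c
  · obtain ⟨c, hc, hac⟩ := hlate
    have hbdd : BddAbove (crossSet ρm ρp X b) := ⟨b, fun x hx => hx.2.1.le⟩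
    have hcτ : c ≤ sSup (crossSet ρm ρp X b) := le_csSup hbdd hc
    have haτ := hac.trans_le hcτ
    have hev : ∀ᶠ s in 𝓝[<] sSup (crossSet ρm ρp X b), W s = W b := by
      filter_upwards [(hband ⟨c, hc⟩).eventually (Metric.ball_mem_nhds _ one_pos),
        Ioo_mem_nhdsLT haτ] with s hs has
      have hs : |W s - W b| < 1 := hs
      rw [abs_lt] at hs
      rcases hW.values s (ha.trans has.1.le) with h | h <;>
        rcases hW.values b (ha.trans hab) with h' | h' <;> rw [h, h'] at hs ⊢ <;> norm_num at hs
    obtain ⟨l, hl, hlW⟩ := (mem_nhdsLT_iff_exists_Ioo_subset' haτ).1 hev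
    obtain ⟨d, hd, hld⟩ := exists_lt_of_lt_csSup ⟨c, hc⟩ (max_lt haτ hl)
    obtain ⟨e, he, hde⟩ := exists_gt_mem_crossSet hX hd
    have hdW : W d = W b := hlW ⟨(le_max_right _ _).trans_lt hld, hde.trans_le (le_csSup hbdd he)⟩
    exact hcon d ⟨((le_max_left _ _).trans_lt hld).le, hd.2.1.le⟩ hd.2.2 hdW
  · push Not at hlate
    have hanot : a ∉ crossSet ρm ρp X b := fun h => by
      obtain ⟨d, hd, had⟩ := exists_gt_mem_crossSet hX h
      exact (hlate d hd).not_gt had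
    have hset : crossSet ρm ρp X a = crossSet ρm ρp X b := by
      ext c
      refine ⟨fun h => ⟨h.1, h.2.1.trans hab', h.2.2⟩, fun h => ⟨h.1, ?_, h.2.2⟩⟩
      exact (hlate c h).lt_of_ne fun hca => hanot (hca ▸ h)
    have hXa : ρm ≤ X a ∧ X a ≤ ρp := by
      by_contra hXa
      refine hanot ⟨ha, hab', ?_⟩
      by_contra! h
      exact hXa h
    obtain ⟨hband', hempty'⟩ := hW.band a ha hXa.1 hXa.2
    rw [hset] at hband' hempty'
    by_cases hc : (crossSet ρm ρp X b).Nonempty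
    · exact hne (tendsto_nhds_unique (hband' hc) (hband hc))
    · exact hne ((hempty' hc).trans (hempty hc).symm)

/-- Over `[a, b]` the change of the output is compensated by the variation of any function
subject to the same constraint. -/
lemma IsThermostat.edist_add_edist_le (hW : IsThermostat ρm ρp X w W)
    (hX : ContinuousOn X (Ici 0)) {a b : ℝ} (ha : 0 ≤ a) (hab : a ≤ b)
    (hV : ∀ r ∈ Icc a b, (X r, V r) ∈ OSet ρm ρp) :
    edist (W b) (W a) + edist (V b) (W b) ≤
      edist (V a) (W a) + eVariationOn V (Icc a b) := by
  by_cases hne : W a = W b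
  · rw [hne, edist_self, zero_add, add_comm]
    exact (edist_triangle _ (V a) _).trans
      (add_le_add_left (eVariationOn.edist_le V (right_mem_Icc.2 hab) (left_mem_Icc.2 hab)) _)
  · obtain ⟨r, hr, hbeyond, hWr⟩ := hW.exists_beyond_of_ne hX ha hab hne
    have hVr : V r = W b := (hW.eq_of_mem_OSet (ha.trans hr.1) (hV r hr) hbeyond).trans hWr
    rw [← eVariationOn_Icc_add_Icc V hr.1 hr.2, ← add_assoc, ← hVr]
    refine add_le_add ((edist_triangle _ (V a) _).trans ?_)
      (eVariationOn.edist_le V (right_mem_Icc.2 hr.2) (left_mem_Icc.2 hr.2))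
    rw [add_comm]
    exact add_le_add_right (eVariationOn.edist_le V (right_mem_Icc.2 hr.1) (left_mem_Icc.2 hr.1)) _

lemma IsThermostat.eVariationOn_add_edist_le (hW : IsThermostat ρm ρp X w W)
    (hX : ContinuousOn X (Ici 0)) {t : ℝ} (ht : 0 ≤ t)
    (hV : ∀ r ∈ Icc 0 t, (X r, V r) ∈ OSet ρm ρp) (h0 : V 0 = W 0) :
    eVariationOn W (Icc 0 t) + edist (V t) (W t) ≤ eVariationOn V (Icc 0 t) := by
  have hstep : ∀ {a b : ℝ} {S : ENNReal}, 0 ≤ a → a ≤ b → b ≤ t →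
      S + edist (V a) (W a) ≤ eVariationOn V (Icc 0 a) →
      S + edist (W b) (W a) + edist (V b) (W b) ≤ eVariationOn V (Icc 0 b) := by
    intro a b S ha hab hb hS
    rw [← eVariationOn_Icc_add_Icc V ha hab, add_assoc]
    refine (add_le_add_right (hW.edist_add_edist_le hX ha hab
      fun r hr => hV r ⟨ha.trans hr.1, hr.2.trans hb⟩) S).trans ?_
    rw [← add_assoc]
    exact add_le_add_left hS _
  have : Nonempty {u : ℕ → ℝ // Monotone u ∧ ∀ i, u i ∈ Icc 0 t} :=
    eVariationOn.nonempty_monotone_mem ⟨0, le_rfl, ht⟩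
  rw [eVariationOn, ENNReal.iSup_add]
  refine iSup_le ?_
  rintro ⟨n, u, hu, hut⟩
  have hind : ∀ n : ℕ, ∑ i ∈ Finset.range n, edist (W (u (i + 1))) (W (u i)) +
      edist (V (u n)) (W (u n)) ≤ eVariationOn V (Icc 0 (u n)) := by
    intro n
    induction n with
    | zero =>
      have := hstep (S := 0) le_rfl (hut 0).1 (hut 0).2 (by simp [h0])
      rw [Finset.sum_range_zero, zero_add]
      exact le_add_self.trans this
    | succ n ih =>
      rw [Finset.sum_range_succ]
      exact hstep (hut n).1 (hu n.le_succ) (hut _).2 ih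
  refine le_trans ?_ (hstep (hut n).1 (hut n).2 le_rfl (hind n))
  exact add_le_add_left le_self_add _

lemma IsThermostat.boundedVariationOn (hW : IsThermostat ρm ρp X w W) (hρ : ρm < ρp)
    (hX : ContinuousOn X (Ici 0)) {t : ℝ} (ht : 0 ≤ t) : BoundedVariationOn W (Icc 0 t) := by
  have hunif : UniformContinuousOn X (Icc 0 t) :=
    isCompact_Icc.uniformContinuousOn_of_continuous (hX.mono Icc_subset_Ici_self)
  obtain ⟨δ, hδ, hXδ⟩ := Metric.uniformContinuousOn_iff.1 hunif (ρp - ρm) (sub_pos.2 hρ)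
  refine boundedVariationOn_Icc_of_short ht hδ fun a b ha hab hb hlen => ?_
  have habs : ∀ x ∈ Icc a b, |W x| ≤ 1 := fun x hx => by
    rcases hW.values x (ha.trans hx.1) with h | h <;> simp [h]
  by_cases hlow : ∃ r ∈ Icc a b, X r < ρm
  · obtain ⟨r, hr, hrX⟩ := hlow
    refine AntitoneOn.boundedVariationOn_of_abs_le (C := 1) (fun x hx y hy hxy => ?_) habs
    by_contra! hlt
    obtain ⟨q, hq, hqX, hqW⟩ := hW.exists_beyond_of_ne hX (ha.trans hx.1) hxy hlt.ne
    have hq0 : 0 ≤ q := (ha.trans hx.1).trans hq.1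
    have hXq : ρp < X q := hqX.resolve_left fun h => by
      have := (abs_le.1 (habs x hx)).1
      linarith [hW.low q hq0 h]
    have hdist := hXδ q ⟨hq0, hq.2.trans (hy.2.trans hb)⟩ r ⟨ha.trans hr.1, hr.2.trans hb⟩ (by
      rw [Real.dist_eq, abs_lt]
      constructor <;> linarith [hq.1, hq.2, hx.1, hy.2, hr.1, hr.2])
    rw [Real.dist_eq, abs_lt] at hdist
    linarith [hdist.2]
  · refine MonotoneOn.boundedVariationOn (C := 1) (fun x hx y hy hxy => ?_) habs
    by_contra! hlt
    obtain ⟨q, hq, hqX, hqW⟩ := hW.exists_beyond_of_ne hX (ha.trans hx.1) hxy hlt.ne'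
    rcases hqX with h | h
    · exact hlow ⟨q, ⟨hx.1.trans hq.1, hq.2.trans hy.2⟩, h⟩
    · have := (abs_le.1 (habs x hx)).2
      linarith [hW.high q ((ha.trans hx.1).trans hq.1) h]

lemma IsThermostat.apply_zero (hW : IsThermostat ρm ρp X w W) (h0 : (X 0, w) ∈ OSet ρm ρp) :
    W 0 = w := by
  by_cases hbeyond : X 0 < ρm ∨ ρp < X 0
  · exact (hW.eq_of_mem_OSet le_rfl h0 hbeyond).symm
  · push Not at hbeyond
    refine (hW.band 0 le_rfl hbeyond.1 hbeyond.2).2 ?_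
    rintro ⟨c, hc0, hc, -⟩
    exact hc0.not_gt hc

lemma IsThermostat.mem_OSet (hW : IsThermostat ρm ρp X w W) {t : ℝ} (ht : 0 ≤ t) :
    (X t, W t) ∈ OSet ρm ρp := by
  rcases hW.values t ht with h | h
  · refine Or.inr ⟨?_, h⟩
    by_contra hlt
    linarith [hW.low t ht (not_le.1 hlt)]
  · refine Or.inl ⟨?_, h⟩
    by_contra hlt
    linarith [hW.high t ht (not_le.1 hlt)]

end Thermostat

/-- **Variational characterization of the delayed thermostat output**: the output
`W = h_ρ[X; w]` is the unique left-continuous `{-1,1}`-valued function with `W 0 = w`,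
`(X t, W t) ∈ O₋₁ ∪ O₁` for all `t ≥ 0`, minimizing, for every `t ≥ 0`, the total
variation on `[0, t]` among all admissible competitors. -/
theorem thermostat_variational
    (ρm ρp : ℝ) (hρ : ρm < ρp)
    (X : ℝ → ℝ) (hX : ContinuousOn X (Ici 0))
    (w : ℝ) (hw : w = 1 ∨ w = -1) (h0 : (X 0, w) ∈ OSet ρm ρp)
    (W : ℝ → ℝ) (hW : IsThermostat ρm ρp X w W) :
    (W 0 = w ∧ (∀ t : ℝ, 0 ≤ t → (X t, W t) ∈ OSet ρm ρp) ∧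
      (∀ t : ℝ, 0 ≤ t → ∀ V : ℝ → ℝ, Admissible ρm ρp X w t V →
        eVariationOn W (Icc 0 t) ≤ eVariationOn V (Icc 0 t))) ∧
    (∀ W' : ℝ → ℝ,
      ((∀ s : ℝ, 0 < s → Tendsto W' (nhdsWithin s (Iio s)) (nhds (W' s))) ∧
        (∀ s : ℝ, 0 ≤ s → W' s = 1 ∨ W' s = -1) ∧
        W' 0 = w ∧
        (∀ t : ℝ, 0 ≤ t → (X t, W' t) ∈ OSet ρm ρp) ∧
        (∀ t : ℝ, 0 ≤ t → ∀ V : ℝ → ℝ, Admissible ρm ρp X w t V →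
          eVariationOn W' (Icc 0 t) ≤ eVariationOn V (Icc 0 t))) →
      ∀ t : ℝ, 0 ≤ t → W' t = W t) := by
  have hW0 := hW.apply_zero h0
  refine ⟨⟨hW0, fun t => hW.mem_OSet, ?_⟩, ?_⟩
  · rintro t ht V ⟨-, -, hV0, hV⟩
    exact le_self_add.trans (hW.eVariationOn_add_edist_le hX ht hV (hV0.trans hW0.symm))
  · rintro W' ⟨-, -, hW'0, hW', hmin⟩ t ht
    have hle := (hW.eVariationOn_add_edist_le hX ht (fun r hr => hW' r hr.1)
      (hW'0.trans hW0.symm)).trans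
      (hmin t ht W ⟨hW.leftCont, hW.values, hW0, fun r hr => hW.mem_OSet hr.1⟩)
    have hzero : edist (W' t) (W t) ≤ 0 :=
      (ENNReal.add_le_add_iff_left (hW.boundedVariationOn hρ hX ht)).1
        (hle.trans_eq (add_zero _).symm)
    exact edist_le_zero.1 hzero
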